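/- arXiv:0910.2997 — 4 statements merged into one kernel-verified Lean document; each statement's English description precedes it below -/
import Mathlib

section
/- Ramanujan's congruences: for all positive integers n, τ(2n) ≡ 0 (mod 2), τ(3n) ≡ 0 (mod 3), and τ(5n) ≡ 0 (mod 5), where τ is the Fourier coefficient function of the discriminant form Δ. -/
open UpperHalfPlane Complex CongruenceSubgroup MatrixGroups
open scoped ModularForm Real MatrixGroups Manifold

noncomputable section

/-- `q = e^{2 π i τ}`. -/
def qexp (τ : UpperHalfPlane) : ℂ := Complex.exp (2 * π * Complex.I * τ)

/-- `f` has the `q`-expansion `∑ c n qⁿ` at `∞`, with only finitely many negative terms. -/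
def HasExpansion (f : UpperHalfPlane → ℂ) (c : ℤ → ℂ) : Prop :=
  (∃ N : ℤ, ∀ n : ℤ, n < N → c n = 0) ∧
    ∀ τ : UpperHalfPlane, HasSum (fun n : ℤ => c n * qexp τ ^ n) (f τ)

/-- Weakly holomorphic modular forms of weight `k` on `Γ`, together with their
Fourier coefficients. -/
structure WhmForm (Γ : Subgroup SL(2, ℤ)) (k : ℤ) where
  toFun : UpperHalfPlane → ℂ
  coeff : ℤ → ℂ
  holo : MDifferentiable 𝓘(ℂ) 𝓘(ℂ) toFun
  slash_eq : ∀ γ ∈ Γ, toFun ∣[k] γ = toFun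
  expansion : HasExpansion toFun coeff

/-- `f = q^{-m} + O(q^{ℓ+1})`. -/
def IsBasisElt {Γ : Subgroup SL(2, ℤ)} (k ℓ m : ℤ) (f : WhmForm Γ k) : Prop :=
  f.coeff (-m) = 1 ∧ ∀ n : ℤ, n ≠ -m → n ≤ ℓ → f.coeff n = 0

/-- multiplication of a point of the upper half plane by a positive real number. -/
def rscale (a : ℝ) (ha : 0 < a) (τ : UpperHalfPlane) : UpperHalfPlane :=
  ⟨a * τ, by simpa [Complex.mul_im] using mul_pos ha τ.2⟩

/-- `τ ↦ -1/τ` on the upper half plane. -/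
def neginv (τ : UpperHalfPlane) : UpperHalfPlane :=
  ⟨(-(τ : ℂ))⁻¹, τ.im_inv_neg_coe_pos⟩

open ModularForm EisensteinSeries Derivative

/-- `f` is given on the whole upper half plane by the `q`-expansion `∑ cₙ qⁿ`. -/
def HasQSeries (f : UpperHalfPlane → ℂ) (c : PowerSeries ℂ) : Prop :=
  ∀ τ : UpperHalfPlane, HasSum (fun n : ℕ => c.coeff n * qexp τ ^ n) (f τ)

theorem qParam_one_eq_qexp (τ : UpperHalfPlane) : Function.Periodic.qParam 1 τ = qexp τ := by
  simp [Function.Periodic.qParam, qexp]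

namespace HasQSeries

variable {f g : UpperHalfPlane → ℂ} {c d : PowerSeries ℂ}

theorem sub (hf : HasQSeries f c) (hg : HasQSeries g d) : HasQSeries (f - g) (c - d) := fun τ => by
  simpa [sub_mul] using (hf τ).sub (hg τ)

theorem smul (hf : HasQSeries f c) (a : ℂ) : HasQSeries (a • f) (a • c) := fun τ => by
  simpa [mul_assoc] using (hf τ).mul_left a

theorem mul (hf : HasQSeries f c) (hg : HasQSeries g d) : HasQSeries (f * g) (c * d) := fun τ => by
  have h := summable_mul_of_summable_norm (hf τ).summable.norm (hg τ).summable.norm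
  have hs := (summable_norm_sum_mul_antidiagonal_of_summable_norm
    (hf τ).summable.norm (hg τ).summable.norm).of_norm.hasSum
  rw [← (hf τ).summable.tsum_mul_tsum_eq_tsum_sum_antidiagonal (hg τ).summable h,
    (hf τ).tsum_eq, (hg τ).tsum_eq] at hs
  convert! hs using 2 with n
  rw [PowerSeries.coeff_mul, Finset.sum_mul]
  refine Finset.sum_congr rfl fun p hp => ?_
  rw [← Finset.HasAntidiagonal.mem_antidiagonal.mp hp, pow_add]
  ring

theorem normalizedDeriv (hf : HasQSeries f c) :
    HasQSeries (D f) (PowerSeries.mk fun n => n * c.coeff n) := fun τ => by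
  let U : Set ℂ := {w | τ.im / 2 < w.im}
  have hU : IsOpen U := isOpen_lt continuous_const Complex.continuous_im
  have hτU : (τ : ℂ) ∈ U := by
    simpa [U] using τ.im_pos
  let σ : UpperHalfPlane := ⟨⟨0, τ.im / 2⟩, by simpa using τ.im_pos⟩
  let F : ℕ → ℂ → ℂ := fun n w => c.coeff n * Complex.exp (2 * π * Complex.I * w) ^ n
  have hderiv (n : ℕ) (w : ℂ) :
      HasDerivAt (F n) ((2 * π * Complex.I) * (n * F n w)) w := by
    have h1 : HasDerivAt (fun w : ℂ => Complex.exp (2 * π * Complex.I * w))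
        (Complex.exp (2 * π * Complex.I * w) * (2 * π * Complex.I)) w := by
      simpa using ((hasDerivAt_id w).const_mul (2 * π * Complex.I)).cexp
    refine ((h1.pow n).const_mul (c.coeff n)).congr_deriv ?_
    rcases n with _ | n
    · simp
    · simp only [F, Nat.add_sub_cancel, pow_succ]
      ring
  have hle (n : ℕ) (w : ℂ) (hw : w ∈ U) : ‖F n w‖ ≤ ‖c.coeff n * qexp σ ^ n‖ := by
    have hw' : τ.im / 2 < w.im := hw
    have hexp : ‖Complex.exp (2 * π * Complex.I * w)‖ ≤ ‖qexp σ‖ := by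
      rw [qexp, Complex.norm_exp, Complex.norm_exp, Real.exp_le_exp]
      simpa [σ] using mul_le_mul_of_nonneg_left hw'.le Real.two_pi_pos.le
    simp only [F, norm_mul, norm_pow]
    gcongr
  have hs := hasSum_deriv_of_summable_norm (hf σ).summable.norm
    (fun n w _ => (hderiv n w).differentiableAt.differentiableWithinAt) hU hle hτU
  have heq : f ∘ ofComplex =ᶠ[nhds (τ : ℂ)] fun w => ∑' n, F n w := by
    filter_upwards [isOpen_upperHalfPlaneSet.mem_nhds τ.im_pos] with w hw
    rw [Function.comp_apply, ofComplex_apply_of_im_pos hw]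
    exact (hf ⟨w, hw⟩).tsum_eq.symm
  rw [← heq.deriv_eq] at hs
  convert! hs.mul_left (2 * π * Complex.I)⁻¹ using 2 with n
  rw [(hderiv n τ).deriv, inv_mul_cancel_left₀ Complex.two_pi_I_ne_zero]
  simp [F, qexp, mul_assoc]

theorem isBoundedAtImInfty (hf : HasQSeries f c) : IsBoundedAtImInfty f :=
  isBoundedAtImInfty_of_hasSum_qExpansion (c := fun n => c.coeff n) one_pos fun τ => by
    simpa [qParam_one_eq_qexp] using hf τ

theorem coeff_eq {F : Type*} [FunLike F UpperHalfPlane ℂ] {k : ℤ} {f : F}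
    [ModularFormClass F 𝒮ℒ k] (hf : HasQSeries f c) (n : ℕ) :
    c.coeff n = (qExpansion 1 f).coeff n :=
  ModularFormClass.qExpansion_coeff_unique (c := fun n => c.coeff n) one_pos
    one_mem_strictPeriods_SL (fun τ => by simpa [qParam_one_eq_qexp] using hf τ) n

end HasQSeries

theorem hasQSeries_qExpansion {k : ℤ} (f : ModularForm 𝒮ℒ k) : HasQSeries f (qExpansion 1 f) :=
  fun τ => by
    simpa [qParam_one_eq_qexp] using
      ModularForm.hasSum_qExpansion f one_pos one_mem_strictPeriods_SL τ

/-- The first Rankin-Cohen bracket `l g D f - k f D g` of two level one modular forms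
of weights `k` and `l`. -/
def rankinCohen {k l : ℤ} (f : ModularForm 𝒮ℒ k) (g : ModularForm 𝒮ℒ l) :
    UpperHalfPlane → ℂ :=
  (l : ℂ) • (D f * ⇑g) - (k : ℂ) • (⇑f * D g)

section RankinCohen

variable {k l : ℤ} (f : ModularForm 𝒮ℒ k) (g : ModularForm 𝒮ℒ l)

theorem rankinCohen_eq_serreDerivative :
    rankinCohen f g =
      (l : ℂ) • (serreDerivative k f * ⇑g) - (k : ℂ) • (⇑f * serreDerivative l g) := by
  ext τ
  simp [rankinCohen]
  ring

theorem rankinCohen_slash (γ : SL(2, ℤ)) :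
    rankinCohen f g ∣[k + l + 2] γ = rankinCohen f g := by
  have hf : ⇑f ∣[k] γ = ⇑f := f.slash_action_eq' _ ⟨γ, rfl⟩
  have hg : ⇑g ∣[l] γ = ⇑g := g.slash_action_eq' _ ⟨γ, rfl⟩
  have hfd : MDiff ⇑f := f.holo'
  have hgd : MDiff ⇑g := g.holo'
  have h1 := ModularForm.mul_slash_SL2 (k + 2) l γ (serreDerivative k f) g
  have h2 := ModularForm.mul_slash_SL2 k (l + 2) γ f (serreDerivative l g)
  rw [serreDerivative_slash_invariant hfd hf, hg,
    show k + 2 + l = k + l + 2 by ring] at h1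
  rw [serreDerivative_slash_invariant hgd hg, hf,
    show k + (l + 2) = k + l + 2 by ring] at h2
  rw [rankinCohen_eq_serreDerivative, sub_eq_add_neg, SlashAction.add_slash,
    SlashAction.neg_slash, ModularForm.SL_smul_slash, ModularForm.SL_smul_slash, h1, h2]

theorem hasQSeries_rankinCohen {c d : PowerSeries ℂ} (hf : HasQSeries f c) (hg : HasQSeries g d) :
    HasQSeries (rankinCohen f g) ((l : ℂ) • ((PowerSeries.mk fun n => n * c.coeff n) * d) -
      (k : ℂ) • (c * PowerSeries.mk fun n => n * d.coeff n)) :=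
  ((hf.normalizedDeriv.mul hg).smul _).sub ((hf.mul hg.normalizedDeriv).smul _)

/-- The first Rankin-Cohen bracket as a modular form. -/
def rankinCohenForm : ModularForm 𝒮ℒ (k + l + 2) where
  toFun := rankinCohen f g
  slash_action_eq' := fun _ ⟨γ, hγ⟩ => hγ ▸ rankinCohen_slash f g γ
  holo' := by
    have hf := f.holo'
    have hg := g.holo'
    exact (((normalizedDerivOfComplex_mdifferentiable hf).mul hg).const_smul _).sub
      ((hf.mul (normalizedDerivOfComplex_mdifferentiable hg)).const_smul _)
  bdd_at_cusps' {c} hc := by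
    rw [Subgroup.IsArithmetic.isCusp_iff_isCusp_SL2Z] at hc
    rw [OnePoint.isBoundedAt_iff_forall_SL2Z hc]
    intro γ _
    rw [rankinCohen_slash]
    exact (hasQSeries_rankinCohen f g (hasQSeries_qExpansion f)
      (hasQSeries_qExpansion g)).isBoundedAtImInfty

end RankinCohen

open scoped ArithmeticFunction.sigma

theorem qExpansion_E₄_coeff (n : ℕ) :
    (qExpansion 1 E₄).coeff n = (if n = 0 then 1 else 0) + 240 * (σ 3 n : ℂ) := by
  rw [E_qExpansion_coeff _ ⟨2, rfl⟩, show bernoulli 4 = -1 / 30 by decide +kernel]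
  split_ifs with h
  · simp [h]
  · norm_num

theorem qExpansion_E₆_coeff (n : ℕ) :
    (qExpansion 1 E₆).coeff n = (if n = 0 then 1 else 0) - 504 * (σ 5 n : ℂ) := by
  rw [E_qExpansion_coeff _ ⟨3, rfl⟩, show bernoulli 6 = 1 / 42 by decide +kernel]
  split_ifs with h
  · simp [h]
  · norm_num

/-- The convolution `∑_{i + j = n} i σₐ(i) σ_b(j)`. -/
def sigmaConv (a b n : ℕ) : ℤ :=
  ∑ p ∈ Finset.HasAntidiagonal.antidiagonal n, (p.1 : ℤ) * σ a p.1 * σ b p.2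

/-- The `n`-th coefficient of the Rankin-Cohen bracket of `E₄` and `E₆`. -/
theorem rankinCohenForm_E₄_E₆_coeff (n : ℕ) :
    (qExpansion 1 (rankinCohenForm E₄ E₆)).coeff n =
      288 * ((n * (5 * σ 3 n + 7 * σ 5 n) - 2520 * sigmaConv 3 5 n +
        1680 * sigmaConv 5 3 n : ℤ) : ℂ) := by
  rw [← (hasQSeries_rankinCohen E₄ E₆ (hasQSeries_qExpansion E₄)
    (hasQSeries_qExpansion E₆) : HasQSeries (rankinCohenForm E₄ E₆) _).coeff_eq]
  have h4 : (PowerSeries.mk fun n => (n : ℂ) * (qExpansion 1 E₄).coeff n) =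
      (240 : ℂ) • PowerSeries.mk fun n => (n : ℂ) * σ 3 n := by
    ext m; rcases m with _ | m <;> simp [qExpansion_E₄_coeff]; ring
  have h6 : (PowerSeries.mk fun n => (n : ℂ) * (qExpansion 1 E₆).coeff n) =
      (-504 : ℂ) • PowerSeries.mk fun n => (n : ℂ) * σ 5 n := by
    ext m; rcases m with _ | m <;> simp [qExpansion_E₆_coeff]; ring
  have h4' : qExpansion 1 E₄ = 1 + (240 : ℂ) • PowerSeries.mk fun n => (σ 3 n : ℂ) := by
    ext m; simp [qExpansion_E₄_coeff, PowerSeries.coeff_one]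
  have h6' : qExpansion 1 E₆ = 1 - (504 : ℂ) • PowerSeries.mk fun n => (σ 5 n : ℂ) := by
    ext m; simp [qExpansion_E₆_coeff, PowerSeries.coeff_one]
  have hc (a b : ℕ) : ((PowerSeries.mk fun n => (n : ℂ) * σ a n) *
      PowerSeries.mk fun n => (σ b n : ℂ)).coeff n = sigmaConv a b n := by
    simp [sigmaConv, PowerSeries.coeff_mul]
  rw [h4, h6, h4', h6', mul_comm (1 + _)]
  simp only [mul_sub, mul_add, mul_one, smul_mul_assoc, mul_smul_comm, smul_sub, smul_add, map_sub,
    map_add, PowerSeries.coeff_smul, hc, PowerSeries.coeff_mk, smul_eq_mul]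
  push_cast
  ring

/-- A Niebur-type formula for the coefficients of the discriminant. -/
theorem discriminant_coeff (n : ℕ) :
    12 * (qExpansion 1 CuspForm.discriminant).coeff n =
      ((n * (5 * σ 3 n + 7 * σ 5 n) - 2520 * sigmaConv 3 5 n + 1680 * sigmaConv 5 3 n : ℤ) : ℂ) := by
  let W : ModularForm 𝒮ℒ 12 := rankinCohenForm E₄ E₆
  have hW0 : (qExpansion 1 W).coeff 0 = 0 := by
    refine (rankinCohenForm_E₄_E₆_coeff 0).trans ?_
    simp [sigmaConv]
  obtain ⟨a, ha⟩ := CuspForm.exists_smul_discriminant_of_weight_eq_twelve (toCuspForm W hW0)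
  have hcoe : ⇑W = a • ⇑CuspForm.discriminant := by
    rw [← FunLike.coe_smul, ha]; rfl
  have hco (m : ℕ) : (qExpansion 1 W).coeff m =
      a * (qExpansion 1 CuspForm.discriminant).coeff m := by
    rw [hcoe, ModularForm.qExpansion_smul one_pos one_mem_strictPeriods_SL,
      PowerSeries.coeff_smul, smul_eq_mul]
  have h1 := (hco 1).symm.trans (rankinCohenForm_E₄_E₆_coeff 1)
  rw [CuspForm.coe_discriminant, discriminant_qExpansion_coeff_one, mul_one] at h1
  have ha' : a = 3456 := by
    rw [h1]
    norm_num [sigmaConv, Finset.Nat.antidiagonal_succ]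
  have hn := (hco n).symm.trans (rankinCohenForm_E₄_E₆_coeff n)
  rw [ha'] at hn
  linear_combination hn / 288

theorem twelve_dvd_sigma (n : ℕ) : (12 : ℤ) ∣ 5 * σ 3 n + 7 * σ 5 n := by
  have hd : ∀ x : ZMod 12, 5 * x ^ 3 + 7 * x ^ 5 = 0 := by decide
  rw [ArithmeticFunction.sigma_apply, ArithmeticFunction.sigma_apply]
  push_cast
  rw [Finset.mul_sum, Finset.mul_sum, ← Finset.sum_add_distrib]
  refine Finset.dvd_sum fun d _ => (ZMod.intCast_zmod_eq_zero_iff_dvd _ 12).mp ?_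
  simpa using hd d

theorem three_dvd_sigmaConv {n : ℕ} (hn : 3 ∣ n) : (3 : ℤ) ∣ sigmaConv 5 3 n := by
  have hσ (m : ℕ) : (σ 5 m : ZMod 3) = σ 3 m := by
    have hd : ∀ x : ZMod 3, x ^ 5 = x ^ 3 := by decide
    simp [ArithmeticFunction.sigma_apply, hd]
  refine (ZMod.intCast_zmod_eq_zero_iff_dvd _ 3).mp ?_
  have h1 : ((sigmaConv 5 3 n : ℤ) : ZMod 3) =
      ∑ p ∈ Finset.HasAntidiagonal.antidiagonal n, (p.1 : ZMod 3) * σ 3 p.1 * σ 3 p.2 := by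
    simp [sigmaConv, hσ]
  have h2 : ((sigmaConv 5 3 n : ℤ) : ZMod 3) =
      ∑ p ∈ Finset.HasAntidiagonal.antidiagonal n, (p.2 : ZMod 3) * σ 3 p.1 * σ 3 p.2 := by
    rw [h1, ← Finset.Nat.sum_antidiagonal_swap]
    exact Finset.sum_congr rfl fun p _ => by simp [mul_right_comm]
  have h3 : ((sigmaConv 5 3 n : ℤ) : ZMod 3) + (sigmaConv 5 3 n : ℤ) = 0 := by
    nth_rewrite 1 [h1]
    rw [h2, ← Finset.sum_add_distrib]
    refine Finset.sum_eq_zero fun p hp => ?_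
    have hp' : (p.1 : ZMod 3) + p.2 = 0 := by
      rw [← Nat.cast_add, Finset.HasAntidiagonal.mem_antidiagonal.mp hp]
      exact (ZMod.natCast_eq_zero_iff _ _).mpr hn
    linear_combination (σ 3 p.1 * σ 3 p.2 : ZMod 3) * hp'
  have h4 : ∀ x : ZMod 3, x + x = 0 → x = 0 := by decide
  exact h4 _ h3

/-- Ramanujan's congruences for the coefficients of `Δ = q ∏ (1-qⁿ)²⁴`. -/
theorem stmt_0 (t : ℕ → ℤ)
    (ht : ∀ τ : UpperHalfPlane,
      HasSum (fun n : ℕ => (t n : ℂ) * qexp τ ^ n)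
        (qexp τ * ∏' n : ℕ, (1 - qexp τ ^ (n + 1)) ^ 24)) :
    ∀ n : ℕ, 0 < n →
      (2 : ℤ) ∣ t (2 * n) ∧ (3 : ℤ) ∣ t (3 * n) ∧ (5 : ℤ) ∣ t (5 * n) := by
  have hq : HasQSeries CuspForm.discriminant (PowerSeries.mk fun n => (t n : ℂ)) := fun τ => by
    have h : CuspForm.discriminant τ = qexp τ * ∏' n : ℕ, (1 - qexp τ ^ (n + 1)) ^ 24 := by
      rw [CuspForm.coe_discriminant, discriminant_eq_q_prod, qParam_one_eq_qexp]
      simp only [ModularForm.eta_q_eq_pow, qexp]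
    simpa [h] using ht τ
  have key (n : ℕ) : 12 * t n = n * (5 * σ 3 n + 7 * σ 5 n) - 2520 * sigmaConv 3 5 n +
      1680 * sigmaConv 5 3 n := by
    have h := discriminant_coeff n
    rw [← hq.coeff_eq n, PowerSeries.coeff_mk] at h
    exact_mod_cast h
  intro n _
  refine ⟨?_, ?_, ?_⟩
  · have h := key (2 * n)
    obtain ⟨m, hm⟩ := twelve_dvd_sigma (2 * n)
    rw [hm] at h
    push_cast at h
    exact ⟨n * m - 105 * sigmaConv 3 5 (2 * n) + 70 * sigmaConv 5 3 (2 * n), by linarith⟩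
  · have h := key (3 * n)
    obtain ⟨m, hm⟩ := twelve_dvd_sigma (3 * n)
    obtain ⟨r, hr⟩ := three_dvd_sigmaConv (dvd_mul_right 3 n)
    rw [hm, hr] at h
    push_cast at h
    exact ⟨n * m - 70 * sigmaConv 3 5 (3 * n) + 140 * r, by linarith⟩
  · have h := key (5 * n)
    push_cast at h
    have h5 : (5 : ℤ) ∣ 12 * t (5 * n) :=
      ⟨n * (5 * σ 3 (5 * n) + 7 * σ 5 (5 * n)) - 504 * sigmaConv 3 5 (5 * n) +
        336 * sigmaConv 5 3 (5 * n), by rw [h]; ring⟩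
    exact (by norm_num : IsCoprime (5 : ℤ) 12).dvd_of_dvd_mul_left h5
end
end

section
/- For any even weight k, writing k = 12ℓ + k' with k' ∈ {0,4,6,8,10,14}, and for every integer m ≥ -ℓ, there exists a unique weakly holomorphic modular form f_{k,m} of weight k on SL_2(ℤ) with Fourier expansion f_{k,m}(τ) = q^{-m} + O(q^{ℓ+1}). -/
open UpperHalfPlane Complex CongruenceSubgroup MatrixGroups
open scoped ModularForm Real MatrixGroups Manifold

noncomputable section

section QParameter

lemma qexp_eq_qParam (τ : UpperHalfPlane) : qexp τ = Function.Periodic.qParam 1 τ := by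
  simp [qexp, Function.Periodic.qParam]

lemma qexp_ne_zero (τ : UpperHalfPlane) : qexp τ ≠ 0 := Complex.exp_ne_zero _

lemma qexp_one_vadd (τ : UpperHalfPlane) : qexp ((1 : ℝ) +ᵥ τ) = qexp τ := by
  simp only [qexp, UpperHalfPlane.coe_vadd, Complex.ofReal_one]
  rw [show 2 * (π : ℂ) * Complex.I * (1 + (τ : ℂ)) = 2 * π * Complex.I * τ + 2 * π * Complex.I by
    ring, Complex.exp_add, Complex.exp_two_pi_mul_I, mul_one]

lemma tendsto_qexp_atImInfty : Filter.Tendsto qexp atImInfty (nhds 0) := by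
  simpa only [← qexp_eq_qParam] using qParam_tendsto_atImInfty one_pos

/-- A function on the upper half plane invariant under `τ ↦ τ + 1` is periodic after extension
to `ℂ` along `ofComplex`. -/
lemma periodic_comp_ofComplex_of_vadd {f : UpperHalfPlane → ℂ}
    (hf : ∀ τ, f ((1 : ℝ) +ᵥ τ) = f τ) : Function.Periodic (f ∘ ofComplex) (1 : ℝ) := by
  intro w
  by_cases! hw : 0 < im w
  · have hw' : 0 < im (w + (1 : ℝ)) := by simpa using hw
    simp only [Function.comp_apply, ofComplex_apply_of_im_pos hw', ofComplex_apply_of_im_pos hw]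
    rw [← hf ⟨w, hw⟩]
    congr 1
    ext
    simp [add_comm]
  · have hw' : im (w + (1 : ℝ)) ≤ 0 := by simpa using hw
    simp only [Function.comp_apply, ofComplex_apply_of_im_nonpos hw',
      ofComplex_apply_of_im_nonpos hw]

/-- A Laurent series in `q` whose coefficients vanish below `N` converges to `a` if and only if
the power series obtained by dividing by `q ^ N` converges to `a * q ^ (-N)`. -/
lemma hasSum_laurent_iff {c : ℤ → ℂ} {N : ℤ} (hc : ∀ n < N, c n = 0) {q a : ℂ} (hq : q ≠ 0) :
    HasSum (fun n : ℤ ↦ c n * q ^ n) a ↔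
      HasSum (fun n : ℕ ↦ c (n + N) * q ^ n) (a * q ^ (-N)) := by
  have hinj : Function.Injective (fun n : ℕ ↦ (n : ℤ) + N) := fun a b h ↦ by simpa using h
  rw [← hinj.hasSum_iff (f := fun n : ℤ ↦ c n * q ^ n)]
  · rw [← hasSum_mul_right_iff (zpow_ne_zero (-N) hq)]
    refine iff_of_eq (congrArg (HasSum · _) (funext fun n ↦ ?_))
    simp only [Function.comp_apply]
    rw [mul_assoc, ← zpow_add₀ hq, add_neg_cancel_right, zpow_natCast]
  · intro n hn
    have : n < N := by
      by_contra! h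
      exact hn ⟨(n - N).toNat, by simp; lia⟩
    simp [hc n this]

lemma isBoundedAtImInfty_of_hasSum {f : UpperHalfPlane → ℂ} {c : ℕ → ℂ}
    (hf : ∀ τ, HasSum (fun n ↦ c n * qexp τ ^ n) (f τ)) : IsBoundedAtImInfty f :=
  isBoundedAtImInfty_of_hasSum_qExpansion one_pos fun τ ↦ by
    simpa only [smul_eq_mul, ← qexp_eq_qParam] using hf τ

lemma eq_zero_of_hasSum_zero {c : ℕ → ℂ}
    (hc : ∀ τ, HasSum (fun n ↦ c n * qexp τ ^ n) 0) (n : ℕ) : c n = 0 := by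
  have := ModularFormClass.qExpansion_coeff_unique (c := c) one_pos one_mem_strictPeriods_SL
    (f := (0 : ModularForm 𝒮ℒ 0)) (fun τ ↦ by simpa [← qexp_eq_qParam] using hc τ) n
  simpa [qExpansion_zero] using this

end QParameter

section Discriminant

/-- The function `Δ / q`. -/
def discriminantDivQ (τ : UpperHalfPlane) : ℂ := ModularForm.discriminant τ / qexp τ

lemma discriminantDivQ_ne_zero (τ : UpperHalfPlane) : discriminantDivQ τ ≠ 0 :=
  div_ne_zero (ModularForm.discriminant_ne_zero τ) (qexp_ne_zero τ)

lemma discriminant_eq_qexp_mul (τ : UpperHalfPlane) :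
    ModularForm.discriminant τ = qexp τ * discriminantDivQ τ := by
  rw [discriminantDivQ, mul_div_cancel₀ _ (qexp_ne_zero τ)]

lemma tendsto_discriminantDivQ_zpow (j : ℤ) :
    Filter.Tendsto (fun τ ↦ discriminantDivQ τ ^ j) atImInfty (nhds 1) := by
  have h : Filter.Tendsto discriminantDivQ atImInfty (nhds 1) := by
    refine ModularForm.tendsto_atImInfty_tprod_one_sub_eta_q_pow.congr fun τ ↦ ?_
    rw [discriminantDivQ, eq_div_iff (qexp_ne_zero τ), ModularForm.discriminant_eq_q_prod,
      qexp_eq_qParam, mul_comm]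
  simpa using h.zpow₀ j (Or.inl one_ne_zero)

lemma discriminantDivQ_one_vadd (τ : UpperHalfPlane) :
    discriminantDivQ ((1 : ℝ) +ᵥ τ) = discriminantDivQ τ := by
  have h := SlashInvariantForm.vAdd_apply_of_mem_strictPeriods CuspForm.discriminant τ
    one_mem_strictPeriods_SL
  rw [CuspForm.coe_discriminant] at h
  rw [discriminantDivQ, discriminantDivQ, qexp_one_vadd, h]

lemma mdifferentiable_zpow {f : UpperHalfPlane → ℂ} (hf : MDifferentiable 𝓘(ℂ) 𝓘(ℂ) f)
    (hf₀ : ∀ τ, f τ ≠ 0) (j : ℤ) : MDifferentiable 𝓘(ℂ) 𝓘(ℂ) fun τ ↦ f τ ^ j := by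
  rw [UpperHalfPlane.mdifferentiable_iff] at hf ⊢
  exact hf.zpow (Or.inl fun _ _ ↦ hf₀ _)

lemma mdifferentiable_discriminant : MDifferentiable 𝓘(ℂ) 𝓘(ℂ) ModularForm.discriminant :=
  CuspForm.discriminant.holo'

lemma mdifferentiable_qexp : MDifferentiable 𝓘(ℂ) 𝓘(ℂ) qexp := by
  rw [UpperHalfPlane.mdifferentiable_iff]
  refine DifferentiableOn.congr (f := fun z ↦ Complex.exp (2 * π * Complex.I * z))
    (by fun_prop) fun z hz ↦ ?_
  simp [qexp, ofComplex_apply_of_im_pos hz]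

lemma mdifferentiable_discriminantDivQ : MDifferentiable 𝓘(ℂ) 𝓘(ℂ) discriminantDivQ :=
  mdifferentiable_discriminant.div mdifferentiable_qexp qexp_ne_zero

lemma slash_mul_discriminant_zpow {f : UpperHalfPlane → ℂ} {a b j : ℤ} {γ : SL(2, ℤ)}
    (hf : f ∣[a] γ = f) (hb : b = a + 12 * j) :
    (fun τ ↦ f τ * ModularForm.discriminant τ ^ j) ∣[b] γ =
      fun τ ↦ f τ * ModularForm.discriminant τ ^ j := by
  have hΔ : ModularForm.discriminant ∣[(12 : ℤ)] γ = ModularForm.discriminant :=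
    CuspForm.discriminant.slash_action_eq' _ ⟨γ, rfl⟩
  ext τ
  have h₁ := congrFun hf τ
  have h₂ := congrFun hΔ τ
  rw [ModularForm.SL_slash_apply] at h₁ h₂ ⊢
  conv_rhs => rw [← h₁, ← h₂]
  rw [mul_zpow, ← zpow_mul, hb, mul_mul_mul_comm, ← zpow_add₀ (denom_ne_zero _ τ)]
  ring_nf

/-- There are no nonzero level one cusp forms in the weights `0, 4, 6, 8, 10, 14`. -/
lemma cuspForm_eq_zero_of_mem {k' : ℤ} (hk' : k' ∈ ({0, 4, 6, 8, 10, 14} : Set ℤ))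
    (f : CuspForm 𝒮ℒ k') : f = 0 := by
  suffices CuspForm.discriminantEquiv f = 0 by simpa using this
  rcases lt_or_ge k' 12 with h | h
  · exact rank_zero_iff_forall_zero.mp (ModularForm.levelOne_neg_weight_rank_zero (by lia)) _
  · obtain rfl : k' = 14 := by
      simp only [Set.mem_insert_iff, Set.mem_singleton_iff] at hk'
      lia
    exact rank_zero_iff_forall_zero.mp ModularForm.levelOne_weight_two_rank_zero _

end Discriminant

section Existence

lemma exists_modularForm_coeff_zero_eq_one {w : ℤ} (hw : Even w) (hw₀ : 0 ≤ w) (hw₂ : w ≠ 2) :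
    ∃ g : ModularForm 𝒮ℒ w, (qExpansion 1 g).coeff 0 = 1 := by
  lift w to ℕ using hw₀
  rcases Nat.eq_zero_or_pos w with rfl | hpos
  · exact ⟨(1 : ModularForm 𝒮ℒ 0), by simp [qExpansion_one]⟩
  · have hw' : Even w := mod_cast hw
    have : 3 ≤ w := by
      obtain ⟨r, rfl⟩ := hw'
      lia
    exact ⟨ModularForm.E this, EisensteinSeries.E_qExpansion_coeff_zero this hw'⟩

lemma exists_isUnit_qExpansion_discriminant :
    ∃ U : PowerSeries ℂ, IsUnit U ∧ qExpansion 1 ModularForm.discriminant = PowerSeries.X * U := by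
  have h₀ : (qExpansion 1 ModularForm.discriminant).coeff 0 = 0 :=
    CuspFormClass.qExpansion_coeff_zero CuspForm.discriminant one_pos one_mem_strictPeriods_SL
  obtain ⟨U, hU⟩ := PowerSeries.X_dvd_iff.mpr (by simpa using h₀)
  refine ⟨U, ?_, hU⟩
  have h₁ := ModularForm.discriminant_qExpansion_coeff_one
  rw [hU, ← zero_add 1, PowerSeries.coeff_succ_X_mul,
    PowerSeries.coeff_zero_eq_constantCoeff_apply] at h₁
  rw [PowerSeries.isUnit_iff_constantCoeff, h₁]
  exact isUnit_one

/-- In weight `12 (n - 1) + k'`, the first `n` coefficients of a level one modular form can be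
prescribed arbitrarily. -/
lemma exists_modularForm_X_pow_dvd {k' : ℤ} (hk' : k' ∈ ({0, 4, 6, 8, 10, 14} : Set ℤ)) (n : ℕ) :
    ∀ (w : ℤ) (_ : w = 12 * (n - 1) + k') (P : PowerSeries ℂ),
      ∃ f : ModularForm 𝒮ℒ w, (PowerSeries.X : PowerSeries ℂ) ^ n ∣ qExpansion 1 f - P := by
  induction n with
  | zero => exact fun w _ P ↦ ⟨0, by simp⟩
  | succ n ih =>
    intro w hw P
    push_cast at hw
    simp only [Set.mem_insert_iff, Set.mem_singleton_iff] at hk'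
    obtain ⟨g, hg⟩ := exists_modularForm_coeff_zero_eq_one (w := w)
      (by rw [Int.even_iff]; lia) (by lia) (by lia)
    obtain ⟨U, ⟨U, rfl⟩, hΔ⟩ := exists_isUnit_qExpansion_discriminant
    obtain ⟨Q, hQ⟩ : (PowerSeries.X : PowerSeries ℂ) ∣ P - P.coeff 0 • qExpansion 1 g := by
      rw [PowerSeries.X_dvd_iff, ← PowerSeries.coeff_zero_eq_constantCoeff_apply, map_sub,
        PowerSeries.coeff_smul, hg]
      simp
    obtain ⟨f, R, hR⟩ := ih (w - 12) (by lia) (Q * ↑U⁻¹)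
    refine ⟨P.coeff 0 • g + (CuspForm.ofMulDiscriminant f).toModularFormₗ, ?_⟩
    have hf : qExpansion 1 (CuspForm.ofMulDiscriminant f).toModularFormₗ =
        (PowerSeries.X : PowerSeries ℂ) * (U : PowerSeries ℂ) * qExpansion 1 f := by
      rw [← hΔ]
      exact ModularForm.qExpansion_mul_coe one_pos one_mem_strictPeriods_SL
        CuspForm.discriminant f
    refine ⟨(U : PowerSeries ℂ) * R, ?_⟩
    rw [FunLike.coe_add, ModularForm.qExpansion_add one_pos one_mem_strictPeriods_SL,
      FunLike.coe_smul, ModularForm.qExpansion_smul one_pos one_mem_strictPeriods_SL, hf]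
    have hUU : (U : PowerSeries ℂ) * ↑U⁻¹ = 1 := U.mul_inv
    linear_combination (PowerSeries.X : PowerSeries ℂ) * U * hR - hQ +
      (PowerSeries.X : PowerSeries ℂ) * Q * hUU

/-- There is a holomorphic modular form `h` such that `h * (Δ / q) ^ (-m)` has `q`-expansion
`1 + O(q ^ n)`. -/
lemma exists_modularForm_mul_discriminantDivQ_zpow {k' : ℤ}
    (hk' : k' ∈ ({0, 4, 6, 8, 10, 14} : Set ℤ)) (n : ℕ) {w : ℤ} (hw : w = 12 * (n - 1) + k')
    (m : ℤ) : ∃ (h : ModularForm 𝒮ℒ w) (P : PowerSeries ℂ),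
      (PowerSeries.X : PowerSeries ℂ) ^ n ∣ P - 1 ∧
      ∀ τ, HasSum (fun i ↦ P.coeff i * qexp τ ^ i) (h τ * discriminantDivQ τ ^ (-m)) := by
  set v : UpperHalfPlane → ℂ := fun τ ↦ discriminantDivQ τ ^ (-m) with hv
  have hvper : Function.Periodic (v ∘ ofComplex) (1 : ℝ) :=
    periodic_comp_ofComplex_of_vadd fun τ ↦ by simp only [hv, discriminantDivQ_one_vadd]
  have hvhol : MDifferentiable 𝓘(ℂ) 𝓘(ℂ) v :=
    mdifferentiable_zpow mdifferentiable_discriminantDivQ discriminantDivQ_ne_zero _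
  have hvlim : Filter.Tendsto v atImInfty (nhds 1) := tendsto_discriminantDivQ_zpow _
  have hvbdd : IsBoundedAtImInfty v := hvlim.isBigO_one ℝ
  have hvan := analyticAt_cuspFunction_zero one_pos hvper hvhol hvbdd
  have hunit : IsUnit (qExpansion 1 v) := by
    rw [PowerSeries.isUnit_iff_constantCoeff, ← PowerSeries.coeff_zero_eq_constantCoeff_apply,
      qExpansion_coeff_zero one_pos hvan hvper, valueAtInfty, hvlim.limUnder_eq]
    exact isUnit_one
  obtain ⟨V, hV⟩ := hunit
  obtain ⟨h, R, hR⟩ := exists_modularForm_X_pow_dvd hk' n w hw ↑V⁻¹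
  have hmul : qExpansion 1 (⇑h * v) = qExpansion 1 h * V := by
    rw [hV]
    exact qExpansion_mul
      (ModularFormClass.analyticAt_cuspFunction_zero h one_pos one_mem_strictPeriods_SL) hvan
  refine ⟨h, qExpansion 1 (⇑h * v), ⟨R * V, ?_⟩, fun τ ↦ ?_⟩
  · rw [hmul]
    have hVV : (↑V⁻¹ : PowerSeries ℂ) * V = 1 := V.inv_mul
    linear_combination (V : PowerSeries ℂ) * hR + hVV
  · have hper := (SlashInvariantFormClass.periodic_comp_ofComplex h
      one_mem_strictPeriods_SL).mul hvper
    have := hasSum_qExpansion (f := ⇑h * v) one_pos hper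
      ((ModularFormClass.holo h).mul hvhol)
      ((ModularFormClass.bdd_at_infty h).mul hvbdd) τ
    simpa only [smul_eq_mul, ← qexp_eq_qParam, Pi.mul_apply] using this

end Existence

section Uniqueness

/-- A weakly holomorphic function of weight `12 ℓ + k'` which is `O(q ^ (ℓ + 1))` vanishes. -/
lemma eq_zero_of_hasSum_of_vanishing {k ℓ k' : ℤ}
    (hk' : k' ∈ ({0, 4, 6, 8, 10, 14} : Set ℤ)) (hk : k = 12 * ℓ + k') {d : UpperHalfPlane → ℂ}
    (hd : MDifferentiable 𝓘(ℂ) 𝓘(ℂ) d) (hslash : ∀ γ : SL(2, ℤ), d ∣[k] γ = d) {e : ℤ → ℂ}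
    (he : ∀ n < ℓ + 1, e n = 0) (hsum : ∀ τ, HasSum (fun n : ℤ ↦ e n * qexp τ ^ n) (d τ)) :
    d = 0 := by
  have hzero : IsZeroAtImInfty fun τ ↦ d τ * ModularForm.discriminant τ ^ (-ℓ) := by
    have hbdd : IsBoundedAtImInfty fun τ ↦ d τ * qexp τ ^ (-(ℓ + 1)) :=
      isBoundedAtImInfty_of_hasSum fun τ ↦ (hasSum_laurent_iff he (qexp_ne_zero τ)).mp (hsum τ)
    have hlim : IsZeroAtImInfty fun τ ↦ qexp τ * discriminantDivQ τ ^ (-ℓ) := by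
      simpa [IsZeroAtImInfty, Filter.ZeroAtFilter] using
        tendsto_qexp_atImInfty.mul (tendsto_discriminantDivQ_zpow (-ℓ))
    refine (hbdd.mul_zeroAtFilter hlim).congr fun τ ↦ ?_
    simp only [Pi.mul_apply]
    rw [discriminant_eq_qexp_mul, mul_zpow, neg_add, zpow_add₀ (qexp_ne_zero τ), zpow_neg_one]
    field_simp [qexp_ne_zero τ]
  have hslash' (γ : SL(2, ℤ)) := slash_mul_discriminant_zpow (j := -ℓ) (b := k') (hslash γ)
    (by lia)
  let F : CuspForm 𝒮ℒ k' :=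
    { toFun τ := d τ * ModularForm.discriminant τ ^ (-ℓ)
      slash_action_eq' := fun _ ⟨γ, hγ⟩ ↦ hγ ▸ hslash' γ
      holo' := hd.mul (mdifferentiable_zpow mdifferentiable_discriminant
        ModularForm.discriminant_ne_zero _)
      zero_at_cusps' {c} hc := by
        rw [Subgroup.IsArithmetic.isCusp_iff_isCusp_SL2Z] at hc
        rw [OnePoint.isZeroAt_iff_forall_SL2Z hc]
        intro γ _
        rw [hslash' γ]
        exact hzero }
  ext τ
  have : d τ * ModularForm.discriminant τ ^ (-ℓ) = 0 :=
    DFunLike.congr_fun (cuspForm_eq_zero_of_mem hk' F) τ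
  simpa [zpow_ne_zero _ (ModularForm.discriminant_ne_zero τ)] using this

end Uniqueness

lemma WhmForm.ext_of_eq {Γ : Subgroup SL(2, ℤ)} {k : ℤ} {f g : WhmForm Γ k}
    (h₁ : f.toFun = g.toFun) (h₂ : f.coeff = g.coeff) : f = g := by
  cases f
  cases g
  congr

/-- Existence and uniqueness of the canonical basis elements `f_{k,m} = q^{-m} + O(q^{ℓ+1})`. -/
theorem stmt_1 (k ℓ k' : ℤ) (hk : Even k) (hk' : k' ∈ ({0, 4, 6, 8, 10, 14} : Set ℤ))
    (hdecomp : k = 12 * ℓ + k') (m : ℤ) (hm : -ℓ ≤ m) :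
    ∃! f : WhmForm ⊤ k, IsBasisElt k ℓ m f := by
  have hn : ((ℓ + m + 1).toNat : ℤ) = ℓ + m + 1 := by lia
  refine existsUnique_of_exists_of_unique ?_ fun f g hf hg ↦ ?_
  · obtain ⟨h, P, hP, hsum⟩ := exists_modularForm_mul_discriminantDivQ_zpow hk'
      (ℓ + m + 1).toNat (w := k + 12 * m) (by lia) m
    have hPcoeff (i : ℕ) (hi : (i : ℤ) ≤ ℓ + m) : P.coeff i = if i = 0 then 1 else 0 := by
      have := PowerSeries.X_pow_dvd_iff.mp hP i (by lia)
      rwa [map_sub, PowerSeries.coeff_one, sub_eq_zero] at this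
    let c : ℤ → ℂ := fun n ↦ if n < -m then 0 else P.coeff (n + m).toNat
    have hc (n : ℤ) (hn : n < -m) : c n = 0 := if_pos hn
    let f : WhmForm ⊤ k :=
      { toFun τ := h τ * ModularForm.discriminant τ ^ (-m)
        coeff := c
        holo := (ModularFormClass.holo h).mul (mdifferentiable_zpow mdifferentiable_discriminant
          ModularForm.discriminant_ne_zero _)
        slash_eq γ _ := slash_mul_discriminant_zpow
          (h.slash_action_eq' _ ⟨γ, rfl⟩) (by lia)
        expansion := by
          refine ⟨⟨-m, hc⟩, fun τ ↦ (hasSum_laurent_iff hc (qexp_ne_zero τ)).mpr ?_⟩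
          convert hsum τ using 1
          · ext i
            simp [c]
          · beta_reduce
            rw [discriminant_eq_qexp_mul, mul_zpow, neg_neg, zpow_neg]
            field_simp [zpow_ne_zero m (qexp_ne_zero τ)] }
    refine ⟨f, ?_, fun n hn hnℓ ↦ ?_⟩
    · simp [f, c, hPcoeff 0 (by lia)]
    · rcases lt_or_ge n (-m) with h' | h'
      · exact hc n h'
      · simp only [f, c, if_neg h'.not_gt]
        rw [hPcoeff _ (by lia), if_neg (by lia)]
  · have he (n : ℤ) (hn : n < ℓ + 1) : (f.coeff - g.coeff) n = 0 := by
      rw [Pi.sub_apply]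
      by_cases h : n = -m
      · rw [h, hf.1, hg.1, sub_self]
      · rw [hf.2 n h (by lia), hg.2 n h (by lia), sub_self]
    have hsum (τ : UpperHalfPlane) :
        HasSum (fun n : ℤ ↦ (f.coeff - g.coeff) n * qexp τ ^ n) ((f.toFun - g.toFun) τ) := by
      simpa only [Pi.sub_apply, sub_mul] using (f.expansion.2 τ).sub (g.expansion.2 τ)
    have hd : f.toFun - g.toFun = 0 :=
      eq_zero_of_hasSum_of_vanishing hk' hdecomp (f.holo.sub g.holo) (fun γ ↦ by
        rw [sub_eq_add_neg, SlashAction.add_slash, SlashAction.neg_slash,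
          f.slash_eq γ trivial, g.slash_eq γ trivial]) he hsum
    refine WhmForm.ext_of_eq (sub_eq_zero.mp hd) (funext fun n ↦ sub_eq_zero.mp ?_)
    rcases lt_or_ge n (ℓ + 1) with h | h
    · exact he n h
    · have := eq_zero_of_hasSum_zero (c := fun i ↦ (f.coeff - g.coeff) (i + (ℓ + 1)))
        (fun τ ↦ by
          simpa only [hd, Pi.zero_apply, zero_mul] using
            (hasSum_laurent_iff he (qexp_ne_zero τ)).mp (hsum τ))
        (n - (ℓ + 1)).toNat
      simpa [h] using this
end
end

section
/- Duality of Fourier coefficients: for any even integer k and any integers m, n, a_k(m,n) = -a_{2-k}(n,m). -/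
open UpperHalfPlane Complex CongruenceSubgroup MatrixGroups
open scoped ModularForm Real MatrixGroups Manifold

noncomputable section

/-- `A m n` is the family of Fourier coefficients `a_k(m,n)` of the canonical basis
`f_{k,m}` (for `m ≥ -ℓ`), extended by `0` out of range. -/
def IsCoeffFamily (k ℓ : ℤ) (f : ℤ → WhmForm ⊤ k) (A : ℤ → ℤ → ℂ) : Prop :=
  (∀ m : ℤ, -ℓ ≤ m → IsBasisElt k ℓ m (f m)) ∧
  (∀ m n : ℤ, -ℓ ≤ m → ℓ < n → A m n = (f m).coeff n) ∧
  (∀ m n : ℤ, m < -ℓ ∨ n ≤ ℓ → A m n = 0)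

/-- The integral of a holomorphic differential `F dz` with `F(-1/z) = z² F(z)` along the segment
from `e^{2πi/3}` to `e^{πi/3}` vanishes, because `z ↦ -1/z` swaps its endpoints. -/
lemma integral_segment_eq_zero {F : ℂ → ℂ} (hF : DifferentiableOn ℂ F {z | 0 < z.im})
    (hS : ∀ z : ℂ, 0 < z.im → F (-z)⁻¹ = z ^ 2 * F z) :
    ∫ x : ℝ in (-1 / 2)..(1 / 2), F (x + (√3 / 2 : ℝ) * Complex.I) = 0 := by
  have h3 : √3 ^ 2 = 3 := Real.sq_sqrt (by norm_num)
  have h3' : 0 ≤ √3 := Real.sqrt_nonneg 3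
  have mem_iff (z : ℂ) : z ∈ Metric.ball (2 * Complex.I) √3 ↔ normSq z + 1 < 4 * z.im := by
    rw [mem_ball_iff_norm, Complex.norm_def, Real.sqrt_lt_sqrt_iff (normSq_nonneg _),
      normSq_apply, normSq_apply]
    simp only [sub_re, mul_re, sub_im, mul_im, re_ofNat, im_ofNat, Complex.I_re, Complex.I_im]
    constructor <;> intro h <;> nlinarith
  have im_pos {z : ℂ} (hz : z ∈ Metric.ball (2 * Complex.I) √3) : 0 < z.im := by
    have := (mem_iff z).1 hz
    have := normSq_nonneg z
    linarith
  have inv_mem {z : ℂ} (hz : z ∈ Metric.ball (2 * Complex.I) √3) :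
      (-z)⁻¹ ∈ Metric.ball (2 * Complex.I) √3 := by
    have hpos : 0 < normSq z := normSq_pos.2 (by rintro rfl; exact lt_irrefl _ (im_pos hz))
    rw [mem_iff] at hz ⊢
    rw [map_inv₀, normSq_neg, inv_im, normSq_neg, neg_im, neg_neg]
    field_simp
    linarith
  obtain ⟨G, hG⟩ := (hF.mono fun z hz => im_pos hz).isExactOn_ball
  have hderiv {z : ℂ} (hz : z ∈ Metric.ball (2 * Complex.I) √3) :
      HasDerivAt (fun w => G (-w)⁻¹ - G w) 0 z := by
    have hz0 : z ≠ 0 := by rintro rfl; exact lt_irrefl _ (im_pos hz)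
    have h1 : HasDerivAt (fun w : ℂ => (-w)⁻¹) (1 / z ^ 2) z := by
      simpa using (hasDerivAt_neg z).fun_inv (neg_ne_zero.2 hz0)
    have h2 := ((hG _ (inv_mem hz)).comp z h1).sub (hG z hz)
    have hzero : F (-z)⁻¹ * (1 / z ^ 2) - F z = 0 := by
      rw [hS z (im_pos hz)]
      field_simp
      ring
    rwa [hzero] at h2
  have hconst {z : ℂ} (hz : z ∈ Metric.ball (2 * Complex.I) √3) : G (-z)⁻¹ = G z := by
    have hI : Complex.I ∈ Metric.ball (2 * Complex.I) √3 := by rw [mem_iff]; norm_num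
    have := (convex_ball (2 * Complex.I) √3).is_const_of_fderivWithin_eq_zero (𝕜 := ℂ)
      (f := fun w => G (-w)⁻¹ - G w)
      (fun w hw => (hderiv hw).differentiableAt.differentiableWithinAt)
      (fun w hw => by
        rw [fderivWithin_of_isOpen Metric.isOpen_ball hw, (hderiv hw).hasFDerivAt.fderiv]
        ext; simp) hz hI
    simpa [sub_eq_zero, inv_neg] using this
  have hseg {x : ℝ} (hx : x ∈ Set.uIcc (-1 / 2 : ℝ) (1 / 2)) :
      (x + (√3 / 2 : ℝ) * Complex.I : ℂ) ∈ Metric.ball (2 * Complex.I) √3 := by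
    rw [Set.uIcc_of_le (by norm_num)] at hx
    rw [mem_iff, normSq_add_mul_I]
    simp only [add_im, mul_im, ofReal_im, ofReal_re, Complex.I_re, Complex.I_im]
    have hx2 : x ^ 2 ≤ 1 / 4 := by nlinarith [hx.1, hx.2]
    have h1 : 1 < √3 := by nlinarith
    nlinarith
  have hends : (-((-1 / 2 : ℝ) + (√3 / 2 : ℝ) * Complex.I : ℂ))⁻¹
      = (1 / 2 : ℝ) + (√3 / 2 : ℝ) * Complex.I := by
    apply inv_eq_of_mul_eq_one_left
    have : ((√3 : ℝ) : ℂ) ^ 2 = 3 := by exact_mod_cast h3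
    push_cast
    linear_combination (1 / 4 : ℂ) * this - (√3 : ℂ) ^ 2 / 4 * I_sq
  rw [intervalIntegral.integral_eq_sub_of_hasDerivAt
    (f := fun x : ℝ => G (x + (√3 / 2 : ℝ) * Complex.I))]
  · rw [← hends, hconst (hseg Set.left_mem_uIcc), sub_self]
  · intro x hx
    exact HasDerivAt.comp_ofReal (HasDerivAt.comp_add_const (x : ℂ) _ (hG _ (hseg hx)))
  · apply ContinuousOn.intervalIntegrable
    exact hF.continuousOn.comp (by fun_prop) fun x hx => im_pos (hseg hx)

/-- Integrating a generalized `q`-series over a horizontal period picks out its constant term. -/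
lemma hasSum_integral_qexp {ι : Type*} [Countable ι] {c : ι → ℂ} {e : ι → ℤ} {F : ℂ → ℂ}
    (hF : ∀ τ : ℍ, HasSum (fun i => c i * qexp τ ^ e i) (F τ)) {y : ℝ} (hy : 0 < y) :
    HasSum (fun i => if e i = 0 then c i else 0)
      (∫ x : ℝ in (-1 / 2)..(1 / 2), F (x + y * Complex.I)) := by
  have key (i : ι) (x : ℝ) : cexp (2 * π * Complex.I * (x + y * Complex.I)) ^ e i
      = cexp (2 * π * Complex.I * (y * Complex.I)) ^ e i * cexp (2 * π * Complex.I * e i * x) := by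
    rw [← Complex.exp_int_mul, ← Complex.exp_int_mul, ← Complex.exp_add]
    congr 1; ring
  have norm_key (i : ι) (x : ℝ) : ‖c i * cexp (2 * π * Complex.I * (x + y * Complex.I)) ^ e i‖
      = ‖c i * cexp (2 * π * Complex.I * (y * Complex.I)) ^ e i‖ := by
    have : (2 * π * Complex.I * e i * x : ℂ) = (2 * π * e i * x : ℝ) * Complex.I := by
      push_cast; ring
    rw [key, ← mul_assoc, norm_mul _ (cexp (2 * π * Complex.I * e i * x)), this,
      Complex.norm_exp_ofReal_mul_I, mul_one]
  have hsum (x : ℝ) : HasSum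
      (fun i => c i * cexp (2 * π * Complex.I * (x + y * Complex.I)) ^ e i)
      (F (x + y * Complex.I)) := hF ⟨x + y * Complex.I, by simpa using hy⟩
  have hsummable : Summable fun i => ‖c i * cexp (2 * π * Complex.I * (y * Complex.I)) ^ e i‖ := by
    simpa using (hsum 0).summable.norm
  have hint (i : ι) :
      ∫ x : ℝ in (-1 / 2)..(1 / 2), c i * cexp (2 * π * Complex.I * (x + y * Complex.I)) ^ e i
      = if e i = 0 then c i else 0 := by
    split_ifs with h
    · simp [h]; norm_num
    · simp_rw [key]
      have hne : (2 * π * Complex.I * e i : ℂ) ≠ 0 := by simp [Real.pi_ne_zero, h]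
      rw [intervalIntegral.integral_const_mul, intervalIntegral.integral_const_mul,
        integral_exp_mul_complex hne]
      have : (2 * π * Complex.I * e i * (1 / 2 : ℝ) : ℂ)
          = 2 * π * Complex.I * e i * (-1 / 2 : ℝ) + e i * (2 * π * Complex.I) := by push_cast; ring
      rw [this, Complex.exp_add, Complex.exp_int_mul_two_pi_mul_I]
      simp
  simp_rw [← hint]
  refine intervalIntegral.hasSum_integral_of_dominated_convergence
    (fun i _ => ‖c i * cexp (2 * π * Complex.I * (y * Complex.I)) ^ e i‖) ?_ ?_ ?_ ?_ ?_
  · intro i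
    refine Continuous.aestronglyMeasurable ?_
    simp_rw [key]
    fun_prop
  · exact fun i => .of_forall fun x _ => (norm_key i x).le
  · exact .of_forall fun _ _ => hsummable
  · exact _root_.intervalIntegrable_const
  · exact .of_forall fun x _ => hsum x

/-- The transformation law of a form of weight `k` under `τ ↦ -1/τ`. -/
lemma WhmForm.ofComplex_neg_inv {k : ℤ} (f : WhmForm ⊤ k) {z : ℂ} (hz : 0 < z.im) :
    f.toFun (ofComplex (-z)⁻¹) = z ^ k * f.toFun (ofComplex z) := by
  have hz0 : z ≠ 0 := by rintro rfl; simp at hz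
  have h := congrFun (f.slash_eq ModularGroup.S (Subgroup.mem_top _)) ⟨z, hz⟩
  rw [ModularForm.SL_slash_apply, UpperHalfPlane.modular_S_smul,
    ModularGroup.denom_S] at h
  have hz' : 0 < (-z)⁻¹.im := UpperHalfPlane.im_inv_neg_coe_pos ⟨z, hz⟩
  rw [ofComplex_apply_of_im_pos hz, ofComplex_apply_of_im_pos hz', ← h, mul_comm, mul_assoc]
  simp [zpow_ne_zero k hz0]

/-- The constant term of the product of forms of weights `k` and `2 - k` is zero. -/
lemma WhmForm.hasSum_coeff_mul_coeff_neg {k : ℤ} (f : WhmForm ⊤ k) (g : WhmForm ⊤ (2 - k)) :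
    HasSum (fun p : ℤ × ℤ => if p.1 + p.2 = 0 then f.coeff p.1 * g.coeff p.2 else 0) 0 := by
  have hprod (τ : ℍ) : HasSum
      (fun p : ℤ × ℤ => f.coeff p.1 * g.coeff p.2 * qexp τ ^ (p.1 + p.2))
      (f.toFun (ofComplex τ) * g.toFun (ofComplex τ)) := by
    have hf := f.expansion.2 τ
    have hg := g.expansion.2 τ
    have hq : qexp τ ≠ 0 := Complex.exp_ne_zero _
    have hfg := summable_mul_of_summable_norm hf.summable.norm hg.summable.norm
    simpa only [ofComplex_apply, zpow_add₀ hq, mul_mul_mul_comm] using hf.mul hg hfg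
  have h0 := integral_segment_eq_zero
    (F := fun z => f.toFun (ofComplex z) * g.toFun (ofComplex z))
    ((UpperHalfPlane.mdifferentiable_iff.1 f.holo).mul
      (UpperHalfPlane.mdifferentiable_iff.1 g.holo)) fun z hz => by
    have hz0 : z ≠ 0 := by rintro rfl; simp at hz
    have hpow : z ^ 2 = z ^ k * z ^ (2 - k) := by
      rw [← zpow_add₀ hz0, add_sub_cancel]; norm_cast
    simp only [f.ofComplex_neg_inv hz, g.ofComplex_neg_inv hz, hpow]
    ring
  refine h0 ▸ hasSum_integral_qexp (F := fun z => f.toFun (ofComplex z) * g.toFun (ofComplex z))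
    hprod (y := √3 / 2) (by positivity)

/-- Duality of Fourier coefficients: `a_k(m,n) = -a_{2-k}(n,m)`. -/
theorem stmt_5 (k ℓ k' : ℤ) (hk : Even k) (hk' : k' ∈ ({0, 4, 6, 8, 10, 14} : Set ℤ))
    (hdecomp : k = 12 * ℓ + k')
    (f : ℤ → WhmForm ⊤ k) (A : ℤ → ℤ → ℂ) (hA : IsCoeffFamily k ℓ f A)
    (g : ℤ → WhmForm ⊤ (2 - k)) (B : ℤ → ℤ → ℂ)
    (hB : IsCoeffFamily (2 - k) (-1 - ℓ) g B) (m n : ℤ) :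
    A m n = -B n m := by
  obtain ⟨hf, hA, hA0⟩ := hA
  obtain ⟨hg, hB, hB0⟩ := hB
  by_cases hmn : -ℓ ≤ m ∧ ℓ < n
  · obtain ⟨hm, hn⟩ := hmn
    obtain ⟨hf1, hf0⟩ := hf m hm
    obtain ⟨hg1, hg0⟩ := hg n (by lia)
    have hne : ((-m, m) : ℤ × ℤ) ≠ (n, -n) := fun h => by
      have := congrArg Prod.fst h
      simp only at this
      lia
    have h := ((f m).hasSum_coeff_mul_coeff_neg (g n)).unique
      (hasSum_sum_of_ne_finset_zero (s := {(-m, m), (n, -n)}) ?_)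
    · rw [Finset.sum_pair hne] at h
      simp only [neg_add_cancel, add_neg_cancel, if_true, hf1, hg1, one_mul, mul_one] at h
      rw [hA m n hm hn, hB n m (by lia) (by lia)]
      linear_combination -h
    · rintro ⟨i, j⟩ hij
      simp only [Finset.mem_insert, Finset.mem_singleton, Prod.mk.injEq, not_or, not_and] at hij
      split_ifs with h0
      · simp only at h0 ⊢
        rcases le_or_gt i ℓ with hi | hi
        · rw [hf0 i (by lia) hi, zero_mul]
        · rw [hg0 j (by lia) (by lia), mul_zero]
      · rfl
  · rw [hA0 m n (by lia), hB0 n m (by lia), neg_zero]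
end
end

section
/- Let p be prime, k ∈ {4,6,8,10,14}, and let m, n be positive integers coprime to p, with r, s ≥ 0. For any 0 ≤ t ≤ min(r, s-1): a_k(m p^r, n p^s) = a_k(m p^{r-t-1}, n p^{s-t-1}) + Σ_{j=0}^{t} p^{(s-j)(k-1)} a_k(m p^{r+s-2j}, n). -/
open UpperHalfPlane Complex CongruenceSubgroup MatrixGroups
open scoped ModularForm Real MatrixGroups Manifold

noncomputable section

/-- `a m n` is the integer Fourier coefficient `a_k(m,n)` of the canonical basis element
`f_{k,m} = q^{-m} + O(q)` (here `ℓ = 0`), with `a m n = 0` out of range. -/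
def IsCoeffs (k : ℤ) (a : ℤ → ℤ → ℤ) : Prop :=
  (∀ m : ℤ, 0 ≤ m → ∃ f : WhmForm ⊤ k, IsBasisElt k 0 m f ∧
      ∀ n : ℤ, 0 < n → f.coeff n = (a m n : ℂ)) ∧
  ∀ m n : ℤ, m < 0 ∨ n ≤ 0 → a m n = 0

/-- `f` is holomorphic, modular of weight `k` for the full modular group, and equal to
`∑ c n qⁿ` on the upper half plane. -/
structure IsModularSeries (k : ℤ) (f : ℍ → ℂ) (c : ℤ → ℂ) : Prop where
  holo : MDifferentiable 𝓘(ℂ) 𝓘(ℂ) f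
  slash_eq : ∀ γ : SL(2, ℤ), f ∣[k] γ = f
  hasSum : ∀ τ : ℍ, HasSum (fun n : ℤ => c n * qexp τ ^ n) (f τ)

namespace IsModularSeries

variable {k : ℤ} {f g : ℍ → ℂ} {c d : ℤ → ℂ}

lemma zero : IsModularSeries k 0 0 :=
  ⟨mdifferentiable_const, fun _ => SlashAction.zero_slash _ _, fun τ => by simp⟩

lemma sub (hf : IsModularSeries k f c) (hg : IsModularSeries k g d) :
    IsModularSeries k (f - g) (c - d) where
  holo := hf.holo.sub hg.holo
  slash_eq γ := by
    rw [sub_eq_add_neg, SlashAction.add_slash, SlashAction.neg_slash, hf.slash_eq, hg.slash_eq]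
  hasSum τ := by simpa [sub_mul] using (hf.hasSum τ).sub (hg.hasSum τ)

lemma smul (hf : IsModularSeries k f c) (x : ℂ) : IsModularSeries k (x • f) (x • c) where
  holo := hf.holo.const_smul x
  slash_eq γ := by rw [ModularForm.SL_smul_slash, hf.slash_eq]
  hasSum τ := by simpa [mul_assoc] using (hf.hasSum τ).mul_left x

end IsModularSeries

lemma qexp_zpow (τ : ℍ) (n : ℤ) : qexp τ ^ n = exp (n * (2 * π * Complex.I * τ)) := by
  rw [qexp, exp_int_mul]

/-- There are no nonzero level one cusp forms of weight `4, 6, 8, 10, 14`. -/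
lemma modularForm_eq_zero_of_coeff_zero {k : ℕ} (hk : k ∈ ({4, 6, 8, 10, 14} : Set ℕ))
    (F : ModularForm 𝒮ℒ (k : ℤ)) (h0 : (qExpansion 1 F).coeff 0 = 0) : F = 0 := by
  suffices h : CuspForm.discriminantEquiv (ModularForm.toCuspForm F h0) = 0 by
    simpa [CuspForm.discriminantEquiv.map_eq_zero_iff, DFunLike.ext_iff] using h
  by_cases h12 : k < 12
  · exact rank_zero_iff_forall_zero.mp (ModularForm.levelOne_neg_weight_rank_zero (by lia)) _
  · obtain rfl : k = 14 := by
      simp only [Set.mem_insert_iff, Set.mem_singleton_iff] at hk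
      omega
    exact rank_zero_iff_forall_zero.mp ModularForm.levelOne_weight_two_rank_zero _

lemma IsModularSeries.eq_zero {k : ℕ} (hk : k ∈ ({4, 6, 8, 10, 14} : Set ℕ)) {f : ℍ → ℂ}
    {c : ℤ → ℂ} (hf : IsModularSeries k f c) (hc : ∀ n ≤ 0, c n = 0) : c = 0 := by
  have hsum : ∀ τ : ℍ, HasSum (fun n : ℕ => c n • Function.Periodic.qParam 1 τ ^ n) (f τ) := by
    intro τ
    have := (Nat.cast_injective (R := ℤ)).hasSum_iff (f := fun n : ℤ => c n * qexp τ ^ n)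
      (a := f τ) (fun n hn => by
        rw [hc n, zero_mul]
        by_contra! h
        exact hn ⟨n.toNat, by simp [h.le]⟩)
    simpa [Function.comp_def, qexp, Function.Periodic.qParam] using this.mpr (hf.hasSum τ)
  have hbdd := isBoundedAtImInfty_of_hasSum_qExpansion one_pos hsum
  let F : ModularForm 𝒮ℒ (k : ℤ) :=
    { toFun := f
      slash_action_eq' := fun _ ⟨γ, hγ⟩ => hγ ▸ hf.slash_eq γ
      holo' := hf.holo
      bdd_at_cusps' := fun {x} hx => by
        rw [Subgroup.IsArithmetic.isCusp_iff_isCusp_SL2Z] at hx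
        rw [OnePoint.isBoundedAt_iff_forall_SL2Z hx]
        intro γ _
        exact (hf.slash_eq γ).symm ▸ hbdd }
  have hcoeff : ∀ n : ℕ, c n = (qExpansion 1 F).coeff n :=
    ModularFormClass.qExpansion_coeff_unique (f := F) one_pos one_mem_strictPeriods_SL hsum
  have hF : F = 0 := modularForm_eq_zero_of_coeff_zero hk F (by rw [← hcoeff]; exact hc _ le_rfl)
  ext n
  rcases le_or_gt n 0 with hn | hn
  · exact hc n hn
  · lift n to ℕ using hn.le
    rw [hcoeff, hF]
    simp [qExpansion_zero]

/-- The matrix `(1 x; 0 p)`. -/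
def heckeUpper (p : ℕ) (hp : p ≠ 0) (x : ℤ) : GL (Fin 2) ℝ :=
  .mkOfDetNeZero !![1, (x : ℝ); 0, (p : ℝ)] (by simpa using hp)

/-- The matrix `(p 0; 0 1)`. -/
def heckeDiag (p : ℕ) (hp : p ≠ 0) : GL (Fin 2) ℝ :=
  .mkOfDetNeZero !![(p : ℝ), 0; 0, 1] (by simpa using hp)

lemma heckeUpper_smul (p : ℕ) (hp : p ≠ 0) (x : ℤ) (τ : ℍ) :
    ((heckeUpper p hp x • τ : ℍ) : ℂ) = (τ + x) / p := by
  have hdet : 0 < (heckeUpper p hp x).det.val := by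
    simpa [heckeUpper, Nat.pos_iff_ne_zero] using hp
  rw [coe_smul_of_det_pos hdet]
  simp [heckeUpper, num, denom]

lemma heckeDiag_smul (p : ℕ) (hp : p ≠ 0) (τ : ℍ) :
    ((heckeDiag p hp • τ : ℍ) : ℂ) = p * τ := by
  have hdet : 0 < (heckeDiag p hp).det.val := by
    simpa [heckeDiag, Nat.pos_iff_ne_zero] using hp
  rw [coe_smul_of_det_pos hdet]
  simp [heckeDiag, num, denom]

lemma slash_heckeUpper (p : ℕ) (hp : p ≠ 0) (x k : ℤ) (f : ℍ → ℂ) (τ : ℍ) :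
    (f ∣[k] heckeUpper p hp x) τ = (p : ℂ)⁻¹ * f (heckeUpper p hp x • τ) := by
  have hdet : (heckeUpper p hp x).det.val = p := by simp [heckeUpper]
  have hσ : σ (heckeUpper p hp x) = ContinuousAlgEquiv.refl ℝ ℂ := by
    rw [σ, if_pos (by rw [hdet]; positivity)]
  have hden : denom (heckeUpper p hp x) τ = p := by simp [heckeUpper, denom]
  have hp' : (p : ℂ) ≠ 0 := by exact_mod_cast hp
  rw [ModularForm.slash_apply, hσ, hden, hdet]
  simp only [ContinuousAlgEquiv.refl_apply, Nat.abs_cast, ofReal_natCast, mul_assoc]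
  rw [← zpow_add₀ hp', mul_comm, show k - 1 + -k = -1 by ring, zpow_neg_one]

lemma slash_heckeDiag (p : ℕ) (hp : p ≠ 0) (k : ℤ) (f : ℍ → ℂ) (τ : ℍ) :
    (f ∣[k] heckeDiag p hp) τ = (p : ℂ) ^ (k - 1) * f (heckeDiag p hp • τ) := by
  have hdet : (heckeDiag p hp).det.val = p := by simp [heckeDiag]
  have hσ : σ (heckeDiag p hp) = ContinuousAlgEquiv.refl ℝ ℂ := by
    rw [σ, if_pos (by rw [hdet]; positivity)]
  have hden : denom (heckeDiag p hp) τ = 1 := by simp [heckeDiag, denom]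
  rw [ModularForm.slash_apply, hσ, hden, hdet]
  simp [mul_comm]

/-- The Hecke operator `T_p` in weight `k`, as a sum of slash operators. -/
def heckeOp (p : ℕ) [NeZero p] (k : ℤ) (f : ℍ → ℂ) : ℍ → ℂ :=
  f ∣[k] heckeDiag p (NeZero.ne p) +
    ∑ b : ZMod p, f ∣[k] heckeUpper p (NeZero.ne p) (b.val : ℤ)

section Invariance

variable {p : ℕ} (hp : p ≠ 0) {k : ℤ} {f : ℍ → ℂ}

lemma slash_mul_of_eq (hf : ∀ γ : SL(2, ℤ), f ∣[k] γ = f) {A B : GL (Fin 2) ℝ} (γ δ : SL(2, ℤ))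
    (h : A.val * (γ : Matrix (Fin 2) (Fin 2) ℤ).map (Int.cast : ℤ → ℝ) =
      (δ : Matrix (Fin 2) (Fin 2) ℤ).map (Int.cast : ℤ → ℝ) * B.val) :
    (f ∣[k] A) ∣[k] γ = f ∣[k] B := by
  have h : A * (γ : GL (Fin 2) ℝ) = (δ : GL (Fin 2) ℝ) * B := Units.ext h
  rw [ModularForm.SL_slash, ← SlashAction.slash_mul, h, SlashAction.slash_mul,
    ← ModularForm.SL_slash, hf]

lemma heckeUpper_slash_T_zpow (hf : ∀ γ : SL(2, ℤ), f ∣[k] γ = f) (x y : ℤ) :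
    (f ∣[k] heckeUpper p hp x) ∣[k] (ModularGroup.T ^ y) = f ∣[k] heckeUpper p hp (x + y) := by
  refine slash_mul_of_eq hf _ 1 ?_
  ext i j
  fin_cases i <;> fin_cases j <;>
    simp [heckeUpper, Matrix.mul_apply, Fin.sum_univ_two, ModularGroup.coe_T_zpow, add_comm]

lemma heckeUpper_slash_congr (hf : ∀ γ : SL(2, ℤ), f ∣[k] γ = f) {x y : ℤ}
    (h : (x : ZMod p) = y) : f ∣[k] heckeUpper p hp x = f ∣[k] heckeUpper p hp y := by
  obtain ⟨j, hj⟩ := (ZMod.intCast_eq_intCast_iff_dvd_sub x y p).mp h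
  rw [← SlashAction.slash_one (β := ℤ) (G := SL(2, ℤ)) k (f ∣[k] heckeUpper p hp x)]
  refine slash_mul_of_eq hf _ (ModularGroup.T ^ (-j)) ?_
  have hj' : (y : ℝ) = x + j * p := by exact_mod_cast (by linarith : y = x + j * p)
  ext i j
  fin_cases i <;> fin_cases j <;>
    simp [heckeUpper, Matrix.mul_apply, Fin.sum_univ_two, ModularGroup.coe_T_zpow, hj']

lemma heckeDiag_slash_T (hf : ∀ γ : SL(2, ℤ), f ∣[k] γ = f) :
    (f ∣[k] heckeDiag p hp) ∣[k] ModularGroup.T = f ∣[k] heckeDiag p hp := by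
  refine slash_mul_of_eq hf _ (ModularGroup.T ^ (p : ℤ)) ?_
  rw [ModularGroup.coe_T_zpow]
  ext i j
  fin_cases i <;> fin_cases j <;>
    simp [heckeDiag, Matrix.mul_apply, Fin.sum_univ_two, ModularGroup.coe_T]

lemma heckeDiag_slash_S (hf : ∀ γ : SL(2, ℤ), f ∣[k] γ = f) :
    (f ∣[k] heckeDiag p hp) ∣[k] ModularGroup.S = f ∣[k] heckeUpper p hp 0 := by
  refine slash_mul_of_eq hf _ ModularGroup.S ?_
  ext i j
  fin_cases i <;> fin_cases j <;>
    simp [heckeDiag, heckeUpper, Matrix.mul_apply, Fin.sum_univ_two, ModularGroup.coe_S]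

lemma heckeUpper_zero_slash_S (hf : ∀ γ : SL(2, ℤ), f ∣[k] γ = f) :
    (f ∣[k] heckeUpper p hp 0) ∣[k] ModularGroup.S = f ∣[k] heckeDiag p hp := by
  refine slash_mul_of_eq hf _ ModularGroup.S ?_
  ext i j
  fin_cases i <;> fin_cases j <;>
    simp [heckeDiag, heckeUpper, Matrix.mul_apply, Fin.sum_univ_two, ModularGroup.coe_S]

lemma heckeUpper_slash_S (hf : ∀ γ : SL(2, ℤ), f ∣[k] γ = f) {x y j : ℤ}
    (h : x * y + 1 = p * j) :
    (f ∣[k] heckeUpper p hp x) ∣[k] ModularGroup.S = f ∣[k] heckeUpper p hp y := by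
  refine slash_mul_of_eq hf _ ⟨!![x, -j; p, -y], by rw [Matrix.det_fin_two_of]; linarith⟩ ?_
  have h' : (x : ℝ) * y + 1 = p * j := by exact_mod_cast h
  ext i j
  fin_cases i <;> fin_cases j <;>
    simp [heckeUpper, Matrix.mul_apply, Fin.sum_univ_two, ModularGroup.coe_S] <;> linarith

lemma heckeOp_slash_T [NeZero p] (hf : ∀ γ : SL(2, ℤ), f ∣[k] γ = f) :
    heckeOp p k f ∣[k] ModularGroup.T = heckeOp p k f := by
  rw [heckeOp, SlashAction.add_slash, SlashAction.sum_slash, heckeDiag_slash_T _ hf]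
  congr 1
  refine Fintype.sum_equiv (Equiv.addRight 1) _ _ fun b => ?_
  rw [← zpow_one ModularGroup.T, heckeUpper_slash_T_zpow _ hf]
  exact heckeUpper_slash_congr _ hf (by simp)

lemma heckeOp_slash_S [Fact p.Prime] (hf : ∀ γ : SL(2, ℤ), f ∣[k] γ = f) :
    heckeOp p k f ∣[k] ModularGroup.S = heckeOp p k f := by
  have hp := NeZero.ne p
  rw [heckeOp, SlashAction.add_slash, SlashAction.sum_slash, heckeDiag_slash_S _ hf,
    Fintype.sum_eq_add_sum_compl (0 : ZMod p), Fintype.sum_eq_add_sum_compl (0 : ZMod p)]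
  simp only [ZMod.val_zero, Nat.cast_zero]
  rw [heckeUpper_zero_slash_S _ hf, add_left_comm]
  congr 2
  have hne : ∀ b ∈ ({0} : Finset (ZMod p))ᶜ, b ≠ 0 := by simp
  refine Finset.sum_bij' (fun b _ => -b⁻¹) (fun b _ => -b⁻¹) (by simp) (by simp)
    (by simp [inv_neg]) (by simp [inv_neg]) fun b hb => ?_
  have : ((b.val * (-b⁻¹ : ZMod p).val + 1 : ℤ) : ZMod p) = 0 := by
    simp [mul_inv_cancel₀ (hne b hb)]
  obtain ⟨j, hj⟩ := (ZMod.intCast_zmod_eq_zero_iff_dvd _ p).mp this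
  exact heckeUpper_slash_S _ hf hj

end Invariance

section Expansion

variable {p : ℕ} {k : ℤ} {f : ℍ → ℂ} {c : ℤ → ℂ}

lemma hasSum_slash_heckeDiag (hp : p ≠ 0)
    (hf : ∀ τ : ℍ, HasSum (fun n : ℤ => c n * qexp τ ^ n) (f τ)) (τ : ℍ) :
    HasSum (fun n : ℤ => (if (p : ℤ) ∣ n then (p : ℂ) ^ (k - 1) * c (n / p) else 0) * qexp τ ^ n)
      ((f ∣[k] heckeDiag p hp) τ) := by
  have hp' : (p : ℤ) ≠ 0 := by exact_mod_cast hp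
  rw [slash_heckeDiag, ← (mul_right_injective₀ hp').hasSum_iff]
  · refine ((hf _).mul_left _).congr_fun fun n => ?_
    simp only [Function.comp_apply, dvd_mul_right, if_true, Int.mul_ediv_cancel_left _ hp',
      qexp_zpow, heckeDiag_smul]
    push_cast
    ring_nf
  · intro n hn
    rw [if_neg (fun ⟨j, hj⟩ => hn ⟨j, hj.symm⟩), zero_mul]

lemma sum_qexp_heckeUpper_smul [NeZero p] (τ : ℍ) (n : ℤ) :
    ∑ b : ZMod p, qexp (heckeUpper p (NeZero.ne p) (b.val : ℤ) • τ) ^ n =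
      if (p : ℤ) ∣ n then p * qexp τ ^ (n / p) else 0 := by
  have hp : (p : ℂ) ≠ 0 := NeZero.ne _
  have key : ∀ b : ZMod p, qexp (heckeUpper p (NeZero.ne p) (b.val : ℤ) • τ) ^ n =
      exp (n * (2 * π * Complex.I * τ) / p) * ZMod.stdAddChar (b * (n : ZMod p)) := by
    intro b
    have : b * (n : ZMod p) = ((b.val * n : ℤ) : ZMod p) := by simp
    rw [this, ZMod.stdAddChar_coe, ← Complex.exp_add, qexp_zpow, heckeUpper_smul]
    push_cast
    ring_nf
  simp_rw [key]
  rw [← Finset.mul_sum, AddChar.sum_mulShift _ (ZMod.isPrimitive_stdAddChar p), ZMod.card]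
  simp only [ZMod.intCast_zmod_eq_zero_iff_dvd]
  split_ifs with h
  · obtain ⟨j, rfl⟩ := h
    rw [Int.mul_ediv_cancel_left _ (by exact_mod_cast NeZero.ne p), qexp_zpow, mul_comm]
    push_cast
    congr 2
    field_simp
  · simp

lemma hasSum_sum_slash_heckeUpper [NeZero p]
    (hf : ∀ τ : ℍ, HasSum (fun n : ℤ => c n * qexp τ ^ n) (f τ)) (τ : ℍ) :
    HasSum (fun n : ℤ => c (p * n) * qexp τ ^ n)
      (∑ b : ZMod p, (f ∣[k] heckeUpper p (NeZero.ne p) (b.val : ℤ)) τ) := by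
  have hp : (p : ℤ) ≠ 0 := by exact_mod_cast NeZero.ne p
  have hp' : (p : ℂ) ≠ 0 := NeZero.ne _
  simp_rw [slash_heckeUpper]
  have h := hasSum_sum (s := Finset.univ) fun (b : ZMod p) _ =>
    (hf (heckeUpper p (NeZero.ne p) (b.val : ℤ) • τ)).mul_left (p : ℂ)⁻¹
  simp_rw [← Finset.mul_sum, sum_qexp_heckeUpper_smul] at h
  rw [← (mul_right_injective₀ hp).hasSum_iff] at h
  · rw [Finset.mul_sum] at h
    refine h.congr_fun fun n => ?_
    simp only [Function.comp_apply, dvd_mul_right, if_true, Int.mul_ediv_cancel_left _ hp]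
    field_simp
  · intro n hn
    rw [if_neg (fun ⟨j, hj⟩ => hn ⟨j, hj.symm⟩), mul_zero, mul_zero]

lemma IsModularSeries.heckeOp [Fact p.Prime] (hf : IsModularSeries k f c) :
    IsModularSeries k (heckeOp p k f)
      fun n => (if (p : ℤ) ∣ n then (p : ℂ) ^ (k - 1) * c (n / p) else 0) + c (p * n) where
  holo := by
    refine (hf.holo.slash k _).add ?_
    exact .sum fun b _ => hf.holo.slash k _
  slash_eq := SlashInvariantForm.slash_action_generators_SL2Z (heckeOp_slash_S hf.slash_eq)
    (heckeOp_slash_T hf.slash_eq)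
  hasSum τ := by
    have h := (hasSum_slash_heckeDiag (k := k) (p := p) (NeZero.ne p) hf.hasSum τ).add
      (hasSum_sum_slash_heckeUpper (k := k) (p := p) hf.hasSum τ)
    simp only [← add_mul] at h
    rw [_root_.heckeOp, Pi.add_apply, Finset.sum_apply]
    exact h

end Expansion

lemma WhmForm.isModularSeries {k : ℤ} (f : WhmForm ⊤ k) : IsModularSeries k f.toFun f.coeff :=
  ⟨f.holo, fun γ => f.slash_eq γ trivial, f.expansion.2⟩

lemma IsBasisElt.coeff_of_nonpos {Γ : Subgroup SL(2, ℤ)} {k m n : ℤ} {f : WhmForm Γ k}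
    (hf : IsBasisElt k 0 m f) (hn : n ≤ 0) : f.coeff n = if n = -m then 1 else 0 := by
  split_ifs with h
  · exact h ▸ hf.1
  · exact hf.2 n h hn

/-- The action of `T_p` on the basis: `f_{k,m} | T_p = p^{k-1} f_{k,pm} + f_{k,m/p}`, read off on
positive Fourier coefficients. -/
lemma IsCoeffs.hecke_relation {p : ℕ} (hp : p.Prime) {k : ℕ}
    (hk : k ∈ ({4, 6, 8, 10, 14} : Set ℕ)) {a : ℤ → ℤ → ℤ} (ha : IsCoeffs k a) {m n : ℤ}
    (hm : 0 < m) (hn : 0 < n) :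
    (if (p : ℤ) ∣ n then (p : ℤ) ^ (k - 1) * a m (n / p) else 0) + a m (p * n) =
      (p : ℤ) ^ (k - 1) * a (p * m) n + if (p : ℤ) ∣ m then a (m / p) n else 0 := by
  have : Fact p.Prime := ⟨hp⟩
  have hp0 : 0 < (p : ℤ) := by exact_mod_cast hp.pos
  have hpow : (p : ℂ) ^ ((k : ℤ) - 1) = (p : ℂ) ^ (k - 1) := by
    have : 1 ≤ k := by
      simp only [Set.mem_insert_iff, Set.mem_singleton_iff] at hk
      omega
    rw [← zpow_natCast, Nat.cast_sub this, Nat.cast_one]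
  obtain ⟨f, hf, hfa⟩ := ha.1 m hm.le
  obtain ⟨g, hg, hga⟩ := ha.1 (p * m) (by positivity)
  obtain ⟨φ, d, hd, hd0, hda⟩ : ∃ (φ : ℍ → ℂ) (d : ℤ → ℂ), IsModularSeries k φ d ∧
      (∀ n ≤ 0, d n = if p * n = -m then 1 else 0) ∧
      ∀ n > 0, d n = if (p : ℤ) ∣ m then (a (m / p) n : ℂ) else 0 := by
    by_cases hpm : (p : ℤ) ∣ m
    · obtain ⟨j, rfl⟩ := hpm
      obtain ⟨e, he, hea⟩ := ha.1 j (pos_of_mul_pos_right hm hp0.le).le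
      refine ⟨_, _, e.isModularSeries, fun n hn => ?_, fun n hn => ?_⟩
      · simp only [he.coeff_of_nonpos hn, ← mul_neg, mul_right_inj' hp0.ne']
      · rw [hea n hn, if_pos (dvd_mul_right _ _), Int.mul_ediv_cancel_left _ hp0.ne']
    · refine ⟨0, 0, .zero, fun n _ => ?_, fun n _ => by rw [if_neg hpm]; rfl⟩
      rw [if_neg fun h => hpm ⟨-n, by linarith⟩]
      rfl
  have h0 := (((f.isModularSeries.heckeOp (p := p)).sub
    (g.isModularSeries.smul ((p : ℂ) ^ (k - 1)))).sub hd).eq_zero hk fun j hj => by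
      have hpj : p * j ≤ 0 := mul_nonpos_of_nonneg_of_nonpos hp0.le hj
      simp only [Pi.sub_apply, Pi.smul_apply, smul_eq_mul, hd0 j hj, hg.coeff_of_nonpos hj,
        hf.coeff_of_nonpos hpj, hpow]
      by_cases hpj : (p : ℤ) ∣ j
      · obtain ⟨i, rfl⟩ := hpj
        rw [Int.mul_ediv_cancel_left _ hp0.ne', hf.coeff_of_nonpos (by nlinarith)]
        simp only [← mul_neg, mul_right_inj' hp0.ne', dvd_mul_right, if_true]
        ring
      · have : j ≠ -(p * m) := fun h => hpj ⟨-m, by linarith⟩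
        simp [hpj, this]
  have hn' := congr_fun h0 n
  simp only [Pi.sub_apply, Pi.smul_apply, Pi.zero_apply, smul_eq_mul, hda n hn, hga n hn,
    hfa _ (mul_pos hp0 hn), hpow, sub_eq_zero] at hn'
  have hfn : (p : ℤ) ∣ n → f.coeff (n / p) = a m (n / p) := fun h =>
    hfa _ (Int.ediv_pos_of_pos_of_dvd hn hp0.le h)
  have : (((if (p : ℤ) ∣ n then (p : ℤ) ^ (k - 1) * a m (n / p) else 0) + a m (p * n) : ℤ) : ℂ) =
      (((p : ℤ) ^ (k - 1) * a (p * m) n + if (p : ℤ) ∣ m then a (m / p) n else 0 : ℤ) : ℂ) := by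
    rw [sub_eq_iff_eq_add'] at hn'
    split_ifs at hn' ⊢ <;> simp_all
  exact_mod_cast this

/-- The solution of the three-term recursion `A r (s+1) + P A r (s-1) = P A (r+1) s + A (r-1) s`,
where terms with a negative index are omitted. -/
lemma recursion_step {A : ℕ → ℕ → ℤ} {P : ℤ}
    (h : ∀ r s, (if s = 0 then 0 else P * A r (s - 1)) + A r (s + 1) =
      P * A (r + 1) s + if r = 0 then 0 else A (r - 1) s) (r s : ℕ) :
    A r (s + 1) = (if r = 0 then 0 else A (r - 1) s) + P ^ (s + 1) * A (r + s + 1) 0 := by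
  induction s generalizing r with
  | zero =>
    have h0 := h r 0
    simp only [if_true] at h0
    linear_combination h0
  | succ s ih =>
    have h1 := h r (s + 1)
    have h2 := ih (r + 1)
    simp only [Nat.add_eq_zero_iff, one_ne_zero, and_false, if_false, Nat.add_sub_cancel] at h1 h2
    rw [show r + 1 + s + 1 = r + (s + 1) + 1 by ring] at h2
    rw [h2] at h1
    linear_combination h1

lemma recursion_iterate {A : ℕ → ℕ → ℤ} {P : ℤ}
    (h : ∀ r s, (if s = 0 then 0 else P * A r (s - 1)) + A r (s + 1) =
      P * A (r + 1) s + if r = 0 then 0 else A (r - 1) s) {r s t : ℕ} (htr : t ≤ r)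
    (hts : t + 1 ≤ s) :
    A r s = (if t < r then A (r - t - 1) (s - t - 1) else 0) +
      ∑ j ∈ Finset.range (t + 1), P ^ (s - j) * A (r + s - 2 * j) 0 := by
  induction t with
  | zero =>
    obtain ⟨s, rfl⟩ := Nat.exists_eq_add_of_le' hts
    rw [recursion_step h]
    rcases Nat.eq_zero_or_pos r with rfl | hr
    · simp
    · simp [hr, hr.ne', add_assoc]
  | succ t ih =>
    rw [ih (by omega) (by omega), if_pos (by omega), Finset.sum_range_succ _ (t + 1)]
    obtain ⟨s', hs'⟩ := Nat.exists_eq_add_of_le' hts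
    rw [show s - t - 1 = s' + 1 by omega, recursion_step h,
      show r - t - 1 + s' + 1 = r + s - 2 * (t + 1) by omega,
      show s - (t + 1) = s' + 1 by omega, show r - (t + 1) = r - t - 1 by omega,
      Nat.add_sub_cancel]
    by_cases hr : t + 1 < r
    · rw [if_pos hr, if_neg (by omega)]
      ring
    · rw [if_neg hr, if_pos (by omega)]
      ring

/-- The iterated recursion: for `0 ≤ t ≤ min(r, s-1)`,
`a(m pʳ, n pˢ) = a(m p^{r-t-1}, n p^{s-t-1}) + ∑_{j=0}^t p^{(s-j)(k-1)} a(m p^{r+s-2j}, n)`,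
where the first term is zero when its first argument is non-integral (i.e. when `t = r`). -/
theorem stmt_7 (p : ℕ) (hp : p.Prime) (k : ℕ) (hk : k ∈ ({4, 6, 8, 10, 14} : Set ℕ))
    (a : ℤ → ℤ → ℤ) (ha : IsCoeffs k a) (m n : ℤ) (hm : 0 < m) (hn : 0 < n)
    (hmp : ¬ (p : ℤ) ∣ m) (hnp : ¬ (p : ℤ) ∣ n) (r s t : ℕ)
    (htr : t ≤ r) (hts : t + 1 ≤ s) :
    a (m * p ^ r) (n * p ^ s) =
      (if t < r then a (m * p ^ (r - t - 1)) (n * p ^ (s - t - 1)) else 0) +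
      ∑ j ∈ Finset.range (t + 1),
        (p : ℤ) ^ ((s - j) * (k - 1)) * a (m * p ^ (r + s - 2 * j)) n := by
  have hp0 : (p : ℤ) ≠ 0 := by exact_mod_cast hp.ne_zero
  have hpp : 0 < (p : ℤ) := by exact_mod_cast hp.pos
  have hdvd : ∀ {x : ℤ}, ¬ (p : ℤ) ∣ x → ∀ i : ℕ, (p : ℤ) ∣ x * p ^ i ↔ i ≠ 0 := by
    intro x hx i
    rcases Nat.eq_zero_or_pos i with rfl | hi
    · simpa using hx
    · simpa [hi.ne'] using (dvd_pow_self (p : ℤ) hi.ne').mul_left x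
  have hdiv : ∀ (x : ℤ) {i : ℕ}, i ≠ 0 → x * (p : ℤ) ^ i / p = x * p ^ (i - 1) := by
    intro x i hi
    obtain ⟨i, rfl⟩ := Nat.exists_eq_succ_of_ne_zero hi
    rw [Nat.succ_eq_add_one, pow_succ, ← mul_assoc, Int.mul_ediv_cancel _ hp0,
      Nat.add_sub_cancel]
  have key := recursion_iterate (A := fun i j => a (m * p ^ i) (n * p ^ j))
    (P := (p : ℤ) ^ (k - 1)) (fun i j => ?_) htr hts
  · simpa [← pow_mul, mul_comm] using key
  · have h := ha.hecke_relation hp hk (m := m * p ^ i) (n := n * p ^ j) (by positivity)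
      (by positivity)
    simp only [hdvd hmp, hdvd hnp, ite_not] at h
    rw [show (p : ℤ) * (n * p ^ j) = n * p ^ (j + 1) by ring,
      show (p : ℤ) * (m * p ^ i) = m * p ^ (i + 1) by ring] at h
    convert h using 2
    · split_ifs with hj
      · rfl
      · rw [hdiv n hj]
    · split_ifs with hi
      · rfl
      · rw [hdiv m hi]
end
end
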